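/- Let G be a labeled weighted graph and Q a rooted query tree with label constraint ψ. Define outDegree as the maximum of (a) the number of nodes c ∈ V with φ(c) = ψ(r) that have at least one complete homomorphic match as a successor (as one-node partial matches), and (b) the maximum, over query edges {u, u'} with u the parent of u' and over c ∈ V, of the number of neighbors c' of c in G with φ(c') = ψ(u') such that a subtree match at (u', c') exists. Then each macro-step of the front-element-optimized best-first search process performs at most |V_Q| − 1 extension steps and inserts at most (|V_Q| − 1)·(outDegree − 1) partial matches into B. (Combinatorial core of the bound O(outDegree + log r_H) on the initial latency and on the delay between consecutive results.) -/

import Mathlib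

open Finset
open scoped Classical

noncomputable section

/-- A finite rooted tree on node type `A`, given by its root and parent function. -/
structure QueryTree (A : Type) where
  root : A
  parent : A → A
  parent_root : parent root = root
  reaches : ∀ v : A, ∃ n : ℕ, parent^[n] v = root

variable {V L A : Type}

/-- A (complete) homomorphic match of the query tree `Q` (with label constraint `ψ`)
in the labeled graph `G` (with node labeling `φ`). -/
def IsMatch [Fintype A] [DecidableEq A] (G : SimpleGraph V) (φ : V → L)
    (Q : QueryTree A) (ψ : A → L) (lam : A → V) : Prop :=
  (∀ u : A, φ (lam u) = ψ u) ∧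
    ∀ u : A, u ≠ Q.root → G.Adj (lam u) (lam (Q.parent u))

/-- Weight of a complete homomorphic match: sum of the edge weights of the images of the
query edges (each non-root query node contributes its parent edge). -/
def matchWeight [Fintype A] [DecidableEq A] (w : Sym2 V → ℝ) (Q : QueryTree A)
    (lam : A → V) : ℝ :=
  ∑ u ∈ Finset.univ.filter (fun u : A => u ≠ Q.root), w s(lam u, lam (Q.parent u))

/-- The node set of the subtree `Q_u` of `Q` rooted at `u`: all descendants of `u`. -/
def desc (Q : QueryTree A) (u : A) : Set A := {v | ∃ n : ℕ, Q.parent^[n] v = u}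

/-- A subtree match at `(u, c)`: a homomorphic match of the subtree `Q_u` in `G`
mapping `u` to `c` (values outside `Q_u` are unconstrained). -/
def IsSubtreeMatch [Fintype A] [DecidableEq A] (G : SimpleGraph V) (φ : V → L)
    (Q : QueryTree A) (ψ : A → L) (u : A) (c : V) (μ : A → V) : Prop :=
  μ u = c ∧ (∀ v ∈ desc Q u, φ (μ v) = ψ v) ∧
    ∀ v ∈ desc Q u, v ≠ u → G.Adj (μ v) (μ (Q.parent v))

/-- Weight of a subtree match at `u`: sum of `w` over the images of the edges of `Q_u`. -/
def subtreeWeight [Fintype A] [DecidableEq A] (w : Sym2 V → ℝ) (Q : QueryTree A)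
    (u : A) (μ : A → V) : ℝ :=
  ∑ v ∈ Finset.univ.filter (fun v : A => v ∈ desc Q u ∧ v ≠ u),
    w s(μ v, μ (Q.parent v))

/-- There exists a subtree match at `(u, c)`. -/
def SubtreeMatchExists [Fintype A] [DecidableEq A] (G : SimpleGraph V) (φ : V → L)
    (Q : QueryTree A) (ψ : A → L) (u : A) (c : V) : Prop :=
  ∃ μ : A → V, IsSubtreeMatch G φ Q ψ u c μ

/-- Minimum subtree weight `W(u, c)`: the minimum of the weights of all subtree
matches at `(u, c)` (meaningful whenever such a match exists). -/
def minW [Fintype A] [DecidableEq A] (G : SimpleGraph V) (φ : V → L) (w : Sym2 V → ℝ)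
    (Q : QueryTree A) (ψ : A → L) (u : A) (c : V) : ℝ :=
  sInf {x : ℝ | ∃ μ : A → V, IsSubtreeMatch G φ Q ψ u c μ ∧ subtreeWeight w Q u μ = x}

/-- A rooted prefix of `Q`: contains the root and is closed under taking parents. -/
def IsRootedPrefix (Q : QueryTree A) (S : Finset A) : Prop :=
  Q.root ∈ S ∧ ∀ v ∈ S, Q.parent v ∈ S

/-- Boundary `∂S`: the query nodes outside `S` whose parent lies in `S`. -/
def boundary [Fintype A] [DecidableEq A] (Q : QueryTree A) (S : Finset A) : Finset A :=
  Finset.univ.filter (fun u : A => u ∉ S ∧ Q.parent u ∈ S)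

/-- A partial match on the rooted prefix `S`: a homomorphic match of the induced
subtree `Q[S]` in `G` (values outside `S` are unconstrained). -/
def IsPartialMatch [Fintype A] [DecidableEq A] (G : SimpleGraph V) (φ : V → L)
    (Q : QueryTree A) (ψ : A → L) (S : Finset A) (P : A → V) : Prop :=
  (∀ u ∈ S, φ (P u) = ψ u) ∧ ∀ u ∈ S, u ≠ Q.root → G.Adj (P u) (P (Q.parent u))

/-- The set `{ w({c, c'}) + W(u', c') : c' a neighbor of c, φ(c') = ψ(u'),
a subtree match at (u', c') exists }`. -/
def candSet [Fintype A] [DecidableEq A] (G : SimpleGraph V) (φ : V → L) (w : Sym2 V → ℝ)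
    (Q : QueryTree A) (ψ : A → L) (c : V) (u' : A) : Set ℝ :=
  {x : ℝ | ∃ c' : V, G.Adj c c' ∧ φ c' = ψ u' ∧ SubtreeMatchExists G φ Q ψ u' c' ∧
      x = w s(c, c') + minW G φ w Q ψ u' c'}

/-- Priority of a partial match `P` on the rooted prefix `S`. -/
def priorityVal [Fintype A] [DecidableEq A] (G : SimpleGraph V) (φ : V → L)
    (w : Sym2 V → ℝ) (Q : QueryTree A) (ψ : A → L) (S : Finset A) (P : A → V) : ℝ :=
  (∑ u ∈ S.filter (fun u : A => u ≠ Q.root), w s(P u, P (Q.parent u))) +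
    ∑ u' ∈ boundary Q S, sInf (candSet G φ w Q ψ (P (Q.parent u')) u')


variable [Fintype V] [DecidableEq V] [Fintype A] [DecidableEq A]

/-- A partial-match candidate: a set of query nodes together with an assignment. -/
abbrev PM (V A : Type) := Finset A × (A → V)

/-- A viable partial match: a partial match on a rooted prefix that has at least one
complete homomorphic match as a successor. -/
def Viable (G : SimpleGraph V) (φ : V → L) (Q : QueryTree A) (ψ : A → L)
    (pm : PM V A) : Prop :=
  IsRootedPrefix Q pm.1 ∧ IsPartialMatch G φ Q ψ pm.1 pm.2 ∧
    ∃ lam : A → V, IsMatch G φ Q ψ lam ∧ ∀ u ∈ pm.1, lam u = pm.2 u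

/-- A preorder (DFS) traversal of the rooted tree `Q`: an injective numbering in which
every non-root node comes after its parent and every subtree is contiguous. -/
structure DfsOrder {A : Type} (Q : QueryTree A) : Type where
  ord : A → ℕ
  inj : Function.Injective ord
  parent_lt : ∀ v : A, v ≠ Q.root → ord (Q.parent v) < ord v
  contiguous : ∀ u v x : A, v ∈ desc Q u → ord u ≤ ord x → ord x ≤ ord v → x ∈ desc Q u

/-- The next query node for a non-complete partial match on `S`: the first node of the
boundary `∂S` in the fixed preorder. -/
def nextNode (Q : QueryTree A) (D : DfsOrder Q) (S : Finset A) : A :=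
  if h : (boundary Q S).Nonempty then
    Classical.choose (Finset.exists_min_image (boundary Q S) D.ord h)
  else Q.root

/-- The viable direct successors of `pm` obtained by assigning some graph node to the
next query node. -/
def extOptionsF (G : SimpleGraph V) (φ : V → L) (Q : QueryTree A) (ψ : A → L)
    (D : DfsOrder Q) (pm : PM V A) : Finset (PM V A) :=
  Finset.univ.filter (fun pm' : PM V A =>
    ∃ c' : V, pm'.1 = insert (nextNode Q D pm.1) pm.1 ∧
      pm'.2 = Function.update pm.2 (nextNode Q D pm.1) c' ∧
      Viable G φ Q ψ pm')

/-- `ExtendsTo pm ins t final`: starting from the popped partial match `pm`, the inner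
loop of a macro-step performs `t` extension steps, each time retaining a viable direct
successor of minimum priority at the next query node and inserting all the other viable
direct successors (collected in the multiset `ins`), until the retained partial match
`final` is complete. -/
inductive ExtendsTo (G : SimpleGraph V) (φ : V → L) (w : Sym2 V → ℝ)
    (Q : QueryTree A) (ψ : A → L) (D : DfsOrder Q) :
    PM V A → Multiset (PM V A) → ℕ → PM V A → Prop
  | done (pm : PM V A) (h : pm.1 = Finset.univ) : ExtendsTo G φ w Q ψ D pm 0 0 pm
  | step (pm pm' final : PM V A) (ins : Multiset (PM V A)) (t : ℕ)
      (hne : pm.1 ≠ Finset.univ)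
      (hmem : pm' ∈ extOptionsF G φ Q ψ D pm)
      (hmin : ∀ q ∈ extOptionsF G φ Q ψ D pm,
        priorityVal G φ w Q ψ pm'.1 pm'.2 ≤ priorityVal G φ w Q ψ q.1 q.2)
      (hrest : ExtendsTo G φ w Q ψ D pm' ins t final) :
      ExtendsTo G φ w Q ψ D pm
        (((extOptionsF G φ Q ψ D pm).erase pm').val + ins) (t + 1) final

/-- A state of the front-element-optimized best-first search process: the multiset `B`
of stored partial matches together with the output sequence of complete matches. -/
abbrev SearchState (V A : Type) := Multiset (PM V A) × List (A → V)

/-- A macro-step of the process: remove from `B` a partial match of minimum priority,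
extend it (front-element optimization) to a complete match, insert the bypassed viable
direct successors into `B`, and append the complete match to the output. -/
def StepRel (G : SimpleGraph V) (φ : V → L) (w : Sym2 V → ℝ)
    (Q : QueryTree A) (ψ : A → L) (D : DfsOrder Q)
    (s s' : SearchState V A) : Prop :=
  ∃ (pm final : PM V A) (ins : Multiset (PM V A)) (t : ℕ),
    pm ∈ s.1 ∧
    (∀ q ∈ s.1, priorityVal G φ w Q ψ pm.1 pm.2 ≤ priorityVal G φ w Q ψ q.1 q.2) ∧
    ExtendsTo G φ w Q ψ D pm ins t final ∧
    s'.1 = s.1.erase pm + ins ∧ s'.2 = s.2 ++ [final.2]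

/-- The multiset `B` of the initial state: all viable one-node partial matches
`r ↦ c`. -/
def initB (G : SimpleGraph V) (φ : V → L) (Q : QueryTree A) (ψ : A → L) :
    Multiset (PM V A) :=
  ((Finset.univ.filter (fun c : V =>
      Viable G φ Q ψ (({Q.root} : Finset A), Function.const A c))).val).map
    (fun c : V => (({Q.root} : Finset A), Function.const A c))

/-- The states reachable by a run of the process from the initial state. -/
def ReachableState (G : SimpleGraph V) (φ : V → L) (w : Sym2 V → ℝ)
    (Q : QueryTree A) (ψ : A → L) (D : DfsOrder Q) (s : SearchState V A) : Prop :=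
  Relation.ReflTransGen (StepRel G φ w Q ψ D) (initB G φ Q ψ, ([] : List (A → V))) s

/-- The number of complete homomorphic matches of `Q` in `G` (`r_H`). -/
def rH (G : SimpleGraph V) (φ : V → L) (Q : QueryTree A) (ψ : A → L) : ℕ :=
  (Finset.univ.filter (fun lam : A → V => IsMatch G φ Q ψ lam)).card

/-- `outDegree`: the maximum of (a) the number of root candidates `c` (with the root
label) through which some complete homomorphic match passes as a one-node partial
match, and (b) over all query edges `{u, u'}` with `u` the parent of `u'` and all
`c ∈ V`, the number of neighbors `c'` of `c` with `φ(c') = ψ(u')` admitting a subtree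
match at `(u', c')`. -/
def outDegree (G : SimpleGraph V) (φ : V → L) (Q : QueryTree A) (ψ : A → L) : ℕ :=
  max
    ((Finset.univ.filter (fun c : V => φ c = ψ Q.root ∧
        ∃ lam : A → V, IsMatch G φ Q ψ lam ∧ lam Q.root = c)).card)
    (Finset.univ.sup (fun p : A × V =>
      if p.1 ≠ Q.root then
        (Finset.univ.filter (fun c' : V => G.Adj p.2 c' ∧ φ c' = ψ p.1 ∧
          SubtreeMatchExists G φ Q ψ p.1 c')).card
      else 0))

theorem boundary_nonempty (Q : QueryTree A) {S : Finset A} (hroot : Q.root ∈ S)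
    (hS : S ≠ Finset.univ) : (boundary Q S).Nonempty := by
  by_contra hb
  have closed : ∀ u : A, Q.parent u ∈ S → u ∈ S := by
    intro u hu
    by_contra huS
    exact hb ⟨u, by simp [boundary, huS, hu]⟩
  have iter : ∀ (n : ℕ) (u : A), Q.parent^[n] u ∈ S → u ∈ S := by
    intro n
    induction n with
    | zero => exact fun u hu => hu
    | succ n ih => exact fun u hu => closed u (ih _ (by simpa using hu))
  refine hS (Finset.eq_univ_of_forall fun v => ?_)
  obtain ⟨n, hn⟩ := Q.reaches v
  exact iter n v (hn ▸ hroot)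

theorem nextNode_mem_boundary (Q : QueryTree A) (D : DfsOrder Q) {S : Finset A}
    (hroot : Q.root ∈ S) (hS : S ≠ Finset.univ) : nextNode Q D S ∈ boundary Q S := by
  have h := boundary_nonempty Q hroot hS
  rw [nextNode, dif_pos h]
  exact (Classical.choose_spec (Finset.exists_min_image (boundary Q S) D.ord h)).1

theorem IsMatch.isSubtreeMatch {G : SimpleGraph V} {φ : V → L} {Q : QueryTree A} {ψ : A → L}
    {lam : A → V} (h : IsMatch G φ Q ψ lam) {u : A} (hu : u ≠ Q.root) :
    IsSubtreeMatch G φ Q ψ u (lam u) lam := by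
  refine ⟨rfl, fun v _ => h.1 v, fun v hv hvu => h.2 v ?_⟩
  rintro rfl
  obtain ⟨n, hn⟩ := hv
  exact hu (hn.symm.trans (Function.iterate_fixed Q.parent_root n))

/-- The number of viable extensions of a viable partial match is bounded by `outDegree`. -/
theorem card_extOptionsF_le (G : SimpleGraph V) (φ : V → L) (Q : QueryTree A) (ψ : A → L)
    (D : DfsOrder Q) {pm : PM V A} (hroot : Q.root ∈ pm.1) (hne : pm.1 ≠ Finset.univ) :
    (extOptionsF G φ Q ψ D pm).card ≤ outDegree G φ Q ψ := by
  obtain ⟨hn, hp⟩ : nextNode Q D pm.1 ∉ pm.1 ∧ Q.parent (nextNode Q D pm.1) ∈ pm.1 := by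
    simpa [boundary] using nextNode_mem_boundary Q D hroot hne
  set n := nextNode Q D pm.1 with hn_def
  have hnr : n ≠ Q.root := fun h => hn (h ▸ hroot)
  have hpn : Q.parent n ≠ n := fun h => hn (h ▸ hp)
  let N : Finset V := Finset.univ.filter fun c' : V =>
    G.Adj (pm.2 (Q.parent n)) c' ∧ φ c' = ψ n ∧ SubtreeMatchExists G φ Q ψ n c'
  have hsub : extOptionsF G φ Q ψ D pm ⊆
      N.image fun c' => (insert n pm.1, Function.update pm.2 n c') := by
    rintro ⟨S, P⟩ hq
    obtain ⟨c', hS, hP, hv⟩ := (Finset.mem_filter.mp hq).2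
    simp only [← hn_def] at hS hP
    subst hS hP
    obtain ⟨-, -, lam, hlam, hagree⟩ := hv
    have hc : lam n = c' := by simpa using hagree n (Finset.mem_insert_self _ _)
    have hpc : lam (Q.parent n) = pm.2 (Q.parent n) := by
      simpa [hpn] using hagree (Q.parent n) (Finset.mem_insert_of_mem hp)
    refine Finset.mem_image.mpr ⟨c', Finset.mem_filter.mpr ⟨Finset.mem_univ _, ?_, ?_, ?_⟩, rfl⟩
    · rw [← hpc, ← hc]
      exact (hlam.2 n hnr).symm
    · rw [← hc]
      exact hlam.1 n
    · exact ⟨lam, hc ▸ hlam.isSubtreeMatch hnr⟩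
  have hsup := Finset.le_sup (f := fun p : A × V =>
      if p.1 ≠ Q.root then
        (Finset.univ.filter (fun c' : V => G.Adj p.2 c' ∧ φ c' = ψ p.1 ∧
          SubtreeMatchExists G φ Q ψ p.1 c')).card
      else 0) (Finset.mem_univ (n, pm.2 (Q.parent n)))
  simp only [if_pos hnr] at hsup
  exact (Finset.card_le_card hsub).trans
    (Finset.card_image_le.trans (hsup.trans (le_max_right _ _)))

theorem ExtendsTo.bounds {G : SimpleGraph V} {φ : V → L} {w : Sym2 V → ℝ}
    {Q : QueryTree A} {ψ : A → L} {D : DfsOrder Q} {pm final : PM V A}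
    {ins : Multiset (PM V A)} {t : ℕ} (h : ExtendsTo G φ w Q ψ D pm ins t final)
    (hpm : Viable G φ Q ψ pm) :
    t + pm.1.card = Fintype.card A ∧
      Multiset.card ins ≤ t * (outDegree G φ Q ψ - 1) ∧ ∀ q ∈ ins, Viable G φ Q ψ q := by
  induction h with
  | done pm h => simp [h]
  | step pm pm' final ins t hne hmem hmin hrest ih =>
    have viable_of_mem : ∀ q ∈ extOptionsF G φ Q ψ D pm, Viable G φ Q ψ q := fun q hq => by
      obtain ⟨c', -, -, hv⟩ := (Finset.mem_filter.mp hq).2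
      exact hv
    obtain ⟨ht, hins, hv⟩ := ih (viable_of_mem pm' hmem)
    obtain ⟨c', hS, -, -⟩ := (Finset.mem_filter.mp hmem).2
    have hroot : Q.root ∈ pm.1 := hpm.1.1
    have hn := (Finset.mem_filter.mp (nextNode_mem_boundary Q D hroot hne)).2.1
    have hcard := card_extOptionsF_le G φ Q ψ D hroot hne
    refine ⟨?_, ?_, fun q hq => ?_⟩
    · rw [hS, Finset.card_insert_of_notMem hn] at ht
      omega
    · rw [Multiset.card_add, Finset.card_val, Finset.card_erase_of_mem hmem, Nat.add_one_mul]
      omega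
    · rcases Multiset.mem_add.mp hq with hq | hq
      · exact viable_of_mem q (Finset.mem_of_mem_erase hq)
      · exact hv q hq

theorem ReachableState.viable {G : SimpleGraph V} {φ : V → L} {w : Sym2 V → ℝ}
    {Q : QueryTree A} {ψ : A → L} {D : DfsOrder Q} {s : SearchState V A}
    (hs : ReachableState G φ w Q ψ D s) : ∀ q ∈ s.1, Viable G φ Q ψ q := by
  unfold ReachableState at hs
  induction hs with
  | refl =>
    intro q hq
    obtain ⟨c, hc, rfl⟩ := Multiset.mem_map.mp hq
    exact (Finset.mem_filter.mp hc).2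
  | tail _ hstep ih =>
    obtain ⟨pm, final, ins, t, hpm, -, hext, hB, -⟩ := hstep
    intro q hq
    rw [hB] at hq
    rcases Multiset.mem_add.mp hq with hq | hq
    · exact ih q (Multiset.mem_of_mem_erase hq)
    · exact (hext.bounds (ih pm hpm)).2.2 q hq

/-- each macro-step of the front-element-optimized best-first search
process performs at most `|V_Q| − 1` extension steps and inserts at most
`(|V_Q| − 1)·(outDegree − 1)` partial matches into `B`. -/
theorem stmt12 (G : SimpleGraph V) (φ : V → L) (w : Sym2 V → ℝ)
    (Q : QueryTree A) (ψ : A → L) (D : DfsOrder Q)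
    (s : SearchState V A) (hs : ReachableState G φ w Q ψ D s)
    (pm final : PM V A) (ins : Multiset (PM V A)) (t : ℕ)
    (hpm : pm ∈ s.1)
    (hmin : ∀ q ∈ s.1,
      priorityVal G φ w Q ψ pm.1 pm.2 ≤ priorityVal G φ w Q ψ q.1 q.2)
    (hext : ExtendsTo G φ w Q ψ D pm ins t final) :
    t ≤ Fintype.card A - 1 ∧
    Multiset.card ins ≤ (Fintype.card A - 1) * (outDegree G φ Q ψ - 1) := by
  have hv := hs.viable pm hpm
  obtain ⟨ht, hins, -⟩ := hext.bounds hv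
  have hpos : 0 < pm.1.card := Finset.card_pos.mpr ⟨Q.root, hv.1.1⟩
  have hle : t ≤ Fintype.card A - 1 := by omega
  exact ⟨hle, hins.trans (Nat.mul_le_mul_right _ hle)⟩
end
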